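/- arXiv:1602.01418 — 2 statements merged into one kernel-verified Lean document; each statement's English description precedes it below -/
import Mathlib

section
/- Let N ≥ 2, 0 ≤ p ≤ N, and let P = Σ_{i,j=1}^{N} E_{ij}⊗E_{ji} ∈ End(ℂ^N⊗ℂ^N), R(u) = I − P/u (the rational R-matrix of type A). Let 𝒢 = Σ_{i=1}^{p} E_{ii} − Σ_{i=p+1}^{N} E_{ii} (the matrix of the symmetric pair of type AIII). Then the constant K-matrix K(u) = 𝒢 is a solution of the reflection equation: for all u,v ∈ ℂ with u−v ≠ 0 and u+v ≠ 0, R(u−v) 𝒢₁ R(u+v) 𝒢₂ = 𝒢₂ R(u+v) 𝒢₁ R(u−v) in End(ℂ^N⊗ℂ^N), where 𝒢₁ = 𝒢⊗I and 𝒢₂ = I⊗𝒢. -/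
open Matrix Kronecker Finset

noncomputable section

/-- The index set `I_N` as a subtype of `ℤ` determined by a finite set `S ⊆ ℤ`. -/
abbrev Idx (S : Finset ℤ) : Type := {i : ℤ // i ∈ S}

/-- The matrix unit `E_{ab}` of `End(ℂ^N)` (zero if `a` or `b` is not in the index set). -/
def Emat (S : Finset ℤ) (a b : ℤ) : Matrix (Idx S) (Idx S) ℂ :=
  fun p q => if ((p : ℤ) = a ∧ (q : ℤ) = b) then 1 else 0

/-- The permutation operator `P = Σ_{i,j} E_{ij} ⊗ E_{ji}` on `ℂ^N ⊗ ℂ^N`. -/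
def Pmat (S : Finset ℤ) : Matrix (Idx S × Idx S) (Idx S × Idx S) ℂ :=
  ∑ i ∈ S, ∑ j ∈ S, Emat S i j ⊗ₖ Emat S j i

/-- The operator `Q = Σ_{i,j} θ_{ij} E_{ij} ⊗ E_{-i,-j}` on `ℂ^N ⊗ ℂ^N`. -/
def Qmat (S : Finset ℤ) (θ : ℤ → ℤ → ℂ) : Matrix (Idx S × Idx S) (Idx S × Idx S) ℂ :=
  ∑ i ∈ S, ∑ j ∈ S, θ i j • (Emat S i j ⊗ₖ Emat S (-i) (-j))

/-- The R-matrix `R(u) = I - P/u + Q/(u - κ)` of types B, C, D. -/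
def Rmat (S : Finset ℤ) (θ : ℤ → ℤ → ℂ) (κ u : ℂ) :
    Matrix (Idx S × Idx S) (Idx S × Idx S) ℂ :=
  1 - u⁻¹ • Pmat S + (u - κ)⁻¹ • Qmat S θ

/-- `θ_{ij} = 1` (orthogonal case). -/
def θorth : ℤ → ℤ → ℂ := fun _ _ => 1

/-- `θ_{ij} = sign(i)·sign(j)` (symplectic case). -/
def θsymp : ℤ → ℤ → ℂ := fun i j =>
  (if 0 < i then (1 : ℂ) else -1) * (if 0 < j then (1 : ℂ) else -1)

/-- The rational R-matrix of type A: `R(u) = I - P/u`. -/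
def RA (S : Finset ℤ) (u : ℂ) : Matrix (Idx S × Idx S) (Idx S × Idx S) ℂ :=
  1 - u⁻¹ • Pmat S

theorem Pmat_apply (S : Finset ℤ) (x y : Idx S × Idx S) :
    Pmat S x y = if x.1 = y.2 ∧ x.2 = y.1 then 1 else 0 := by
  obtain ⟨⟨a, ha⟩, ⟨b, hb⟩⟩ := x
  obtain ⟨⟨c, hc⟩, ⟨d, hd⟩⟩ := y
  simp only [Pmat, Matrix.sum_apply, kroneckerMap_apply, Emat, Subtype.mk.injEq]
  rw [Finset.sum_eq_single_of_mem a ha, Finset.sum_eq_single_of_mem c hc]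
  · by_cases h : b = c <;> by_cases h' : a = d <;> simp [h, h', eq_comm (a := d)]
  · intro j _ hj
    simp [hj.symm]
  · intro i _ hi
    simp [hi.symm]

theorem Pmat_eq_submatrix_one (S : Finset ℤ) :
    Pmat S = (1 : Matrix (Idx S × Idx S) (Idx S × Idx S) ℂ).submatrix Prod.swap id := by
  ext x y
  rw [Pmat_apply, submatrix_apply, one_apply]
  simp [Prod.ext_iff, and_comm]

theorem Pmat_mul (S : Finset ℤ) (M : Matrix (Idx S × Idx S) (Idx S × Idx S) ℂ) :
    Pmat S * M = M.submatrix Prod.swap id := by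
  ext x y
  simp [Pmat_eq_submatrix_one, mul_apply, one_apply]

theorem mul_Pmat (S : Finset ℤ) (M : Matrix (Idx S × Idx S) (Idx S × Idx S) ℂ) :
    M * Pmat S = M.submatrix id Prod.swap := by
  ext x y
  have h (z : Idx S × Idx S) : z.swap = y ↔ z = y.swap := by
    rw [← Prod.swap_inj, Prod.swap_swap]
  simp [Pmat_eq_submatrix_one, mul_apply, one_apply, h]

theorem Pmat_mul_self (S : Finset ℤ) : Pmat S * Pmat S = 1 := by
  rw [Pmat_mul, Pmat_eq_submatrix_one, submatrix_submatrix]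
  simp

theorem Pmat_mul_kronecker (S : Finset ℤ) (A B : Matrix (Idx S) (Idx S) ℂ) :
    Pmat S * (A ⊗ₖ B) = (B ⊗ₖ A) * Pmat S := by
  rw [Pmat_mul, mul_Pmat]
  ext x y
  simp [mul_comm]

/-- A constant involution solves the reflection equation for `1 - u⁻¹ • P`, written abstractly:
`A` and `B` are the two copies of the involution, interchanged by the involution `P`. -/
theorem reflection_of_involutions {R : Type*} [Ring R] [Algebra ℂ R] {P A B : R}
    (hP : P * P = 1) (hPA : P * A = B * P) (hPB : P * B = A * P) (hAB : A * B = B * A)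
    (hA : A * A = 1) (hB : B * B = 1) (a b : ℂ) :
    (1 - a • P) * A * (1 - b • P) * B = B * (1 - b • P) * A * (1 - a • P) := by
  have h₁ : P * A * B = B * A * P := by
    rw [hPA, mul_assoc, hPB, mul_assoc]
  have h₂ : A * P * B = B * P * A := by
    rw [mul_assoc, hPB, ← mul_assoc, hA, ← hPA, mul_assoc, hA, one_mul, mul_one]
  have h₃ : P * A * P * B = B * P * A * P := by
    rw [mul_assoc B P A, hPA, mul_assoc B P P, hP, ← mul_assoc, hB, mul_one, one_mul, hB, hP]
  simp only [sub_mul, mul_sub, one_mul, mul_one, smul_mul_assoc, mul_smul_comm]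
  rw [h₁, h₂, h₃, hAB, smul_sub, smul_sub, smul_comm a b]
  abel

theorem sum_Emat_diag (S T : Finset ℤ) :
    ∑ i ∈ T, Emat S i i = diagonal fun x : Idx S => if (x : ℤ) ∈ T then (1 : ℂ) else 0 := by
  ext x y
  simp only [Matrix.sum_apply, Emat, diagonal_apply]
  by_cases h : x = y
  · subst h
    simp
  · have h' : (y : ℤ) ≠ x := fun e => h (Subtype.ext e.symm)
    rw [if_neg h]
    refine Finset.sum_eq_zero fun i _ => if_neg ?_
    rintro ⟨rfl, e⟩
    exact h' e

/-- the constant K-matrix `K(u) = 𝒢 = Σ_{i=1}^{p} E_{ii} - Σ_{i=p+1}^{N} E_{ii}`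
of type AIII solves the reflection equation for the rational R-matrix `R(u) = I - P/u`. -/
theorem reflection_AIII (N p : ℕ) (hN : 2 ≤ N) (hp : p ≤ N)
    (S : Finset ℤ) (hS : S = Finset.Icc (1 : ℤ) (N : ℤ))
    (G : Matrix (Idx S) (Idx S) ℂ)
    (hG : G = (∑ i ∈ Finset.Icc (1 : ℤ) (p : ℤ), Emat S i i)
            - ∑ i ∈ Finset.Icc ((p : ℤ) + 1) (N : ℤ), Emat S i i)
    (u v : ℂ) (h1 : u - v ≠ 0) (h2 : u + v ≠ 0) :
    RA S (u - v) * (G ⊗ₖ (1 : Matrix (Idx S) (Idx S) ℂ)) *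
        RA S (u + v) * ((1 : Matrix (Idx S) (Idx S) ℂ) ⊗ₖ G) =
      ((1 : Matrix (Idx S) (Idx S) ℂ) ⊗ₖ G) * RA S (u + v) *
        (G ⊗ₖ (1 : Matrix (Idx S) (Idx S) ℂ)) * RA S (u - v) := by
  have hGG : G * G = 1 := by
    rw [hG, sum_Emat_diag, sum_Emat_diag, diagonal_sub, diagonal_mul_diagonal, ← diagonal_one]
    congr 1
    ext ⟨x, hx⟩
    rw [hS, Finset.mem_Icc] at hx
    simp only [Finset.mem_Icc]
    rcases le_or_gt x p with h | h
    · rw [if_pos ⟨hx.1, h⟩, if_neg (by lia)]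
      norm_num
    · rw [if_neg (by lia), if_pos ⟨by lia, hx.2⟩]
      norm_num
  refine reflection_of_involutions (Pmat_mul_self S) (Pmat_mul_kronecker S G 1)
    (Pmat_mul_kronecker S 1 G) ?_ ?_ ?_ _ _ <;>
  simp [← mul_kronecker_mul, hGG]
end
end

section
/- Let ℂ² have basis e_{-1}, e_1, P° = Σ_{i,j∈{-1,1}} E_{ij}⊗E_{ji}, R°(u) = I − P°/u. For an operator R on ℂ²⊗ℂ² and 1 ≤ a < b ≤ 4, let R_{ab} denote R acting on tensor factors a and b of (ℂ²)^{⊗4} and identity elsewhere. Then, as an identity of rational functions in u (for u with 2u−1, 2u, 2u+1 ≠ 0), R°₁₂(−1) R°₃₄(−1) R°₁₄(2u−1) R°₁₃(2u) R°₂₄(2u) R°₂₃(2u+1) = R°₂₃(2u+1) R°₂₄(2u) R°₁₃(2u) R°₁₄(2u−1) R°₁₂(−1) R°₃₄(−1) in End((ℂ²)^{⊗4}). -/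
open Matrix Kronecker Finset

noncomputable section

/-- The two-element index set `{-1, 1}` for `ℂ²`. -/
def S2 : Finset ℤ := {-1, 1}

abbrev V2 : Type := Idx S2

/-- Negation `i ↦ -i` on the index set `{-1, 1}`. -/
def nneg (p : V2) : V2 :=
  ⟨-(p : ℤ), by
    have h := p.2
    simp only [S2, Finset.mem_insert, Finset.mem_singleton] at h ⊢
    omega⟩

/-- The rational R-matrix `R°(u) = I - P°/u` of type A on `ℂ² ⊗ ℂ²`. -/
def Ro (u : ℂ) : Matrix (V2 × V2) (V2 × V2) ℂ := 1 - u⁻¹ • Pmat S2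

/-- `sign(i)` for `i ∈ {-1, 1}`. -/
def ssgn : V2 → ℂ := fun i => if 0 < (i : ℤ) then 1 else -1

/-- Partial transpose applied to the first tensor factor of `ℂ² ⊗ ℂ²`, for the transpose
`M ↦ Σ_{i,j} s(i) s(j) M_{ij} E_{-j,-i}` of `2 × 2` matrices (take `s ≡ 1` for `t₊` and
`s = sign` for `t₋`). -/
def pt1 (s : V2 → ℂ) (X : Matrix (V2 × V2) (V2 × V2) ℂ) :
    Matrix (V2 × V2) (V2 × V2) ℂ :=
  fun p q => s p.1 * s q.1 * X (nneg q.1, p.2) (nneg p.1, q.2)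

/-- The fourfold tensor power `(ℂ²)^{⊗4}` index type. -/
abbrev Q4 : Type := V2 × V2 × V2 × V2

/-- `R_{12}` on `(ℂ²)^{⊗4}`. -/
def L12 (M : Matrix (V2 × V2) (V2 × V2) ℂ) : Matrix Q4 Q4 ℂ :=
  fun p q => M (p.1, p.2.1) (q.1, q.2.1) *
    (if (p.2.2.1, p.2.2.2) = (q.2.2.1, q.2.2.2) then 1 else 0)

/-- `R_{13}` on `(ℂ²)^{⊗4}`. -/
def L13 (M : Matrix (V2 × V2) (V2 × V2) ℂ) : Matrix Q4 Q4 ℂ :=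
  fun p q => M (p.1, p.2.2.1) (q.1, q.2.2.1) *
    (if (p.2.1, p.2.2.2) = (q.2.1, q.2.2.2) then 1 else 0)

/-- `R_{14}` on `(ℂ²)^{⊗4}`. -/
def L14 (M : Matrix (V2 × V2) (V2 × V2) ℂ) : Matrix Q4 Q4 ℂ :=
  fun p q => M (p.1, p.2.2.2) (q.1, q.2.2.2) *
    (if (p.2.1, p.2.2.1) = (q.2.1, q.2.2.1) then 1 else 0)

/-- `R_{23}` on `(ℂ²)^{⊗4}`. -/
def L23 (M : Matrix (V2 × V2) (V2 × V2) ℂ) : Matrix Q4 Q4 ℂ :=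
  fun p q => M (p.2.1, p.2.2.1) (q.2.1, q.2.2.1) *
    (if (p.1, p.2.2.2) = (q.1, q.2.2.2) then 1 else 0)

/-- `R_{24}` on `(ℂ²)^{⊗4}`. -/
def L24 (M : Matrix (V2 × V2) (V2 × V2) ℂ) : Matrix Q4 Q4 ℂ :=
  fun p q => M (p.2.1, p.2.2.2) (q.2.1, q.2.2.2) *
    (if (p.1, p.2.2.1) = (q.1, q.2.2.1) then 1 else 0)

/-- `R_{34}` on `(ℂ²)^{⊗4}`. -/
def L34 (M : Matrix (V2 × V2) (V2 × V2) ℂ) : Matrix Q4 Q4 ℂ :=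
  fun p q => M (p.2.2.1, p.2.2.2) (q.2.2.1, q.2.2.2) *
    (if (p.1, p.2.1) = (q.1, q.2.1) then 1 else 0)

/-- The operator `Σ_{i,j} E_{ij} ⊗ E_{ji}` exchanges the two tensor factors. -/
lemma Pmat_apply_s13 (S : Finset ℤ) (p q : Idx S × Idx S) :
    Pmat S p q = if p.1 = q.2 ∧ p.2 = q.1 then 1 else 0 := by
  obtain ⟨⟨a, ha⟩, ⟨b, hb⟩⟩ := p
  obtain ⟨⟨c, hc⟩, ⟨d, hd⟩⟩ := q
  simp only [Pmat, Matrix.sum_apply, kroneckerMap_apply, Emat, ← ite_and, mul_ite, mul_one,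
    mul_zero, Subtype.mk.injEq]
  rw [Finset.sum_eq_single_of_mem a ha, Finset.sum_eq_single_of_mem c hc]
  · congr 1
    grind
  · intro j _ hj
    rw [if_neg (by grind)]
  · intro i _ hi
    exact Finset.sum_eq_zero fun j _ => if_neg (by grind)

/-- The R-matrix `1 - P / u` attached to a permutation `σ` of the basis vectors. -/
def permR {ι : Type*} [DecidableEq ι] (σ : Equiv.Perm ι) (u : ℂ) : Matrix ι ι ℂ :=
  1 - u⁻¹ • σ.permMatrix ℂ

/-- The Yang–Baxter equation for Yang's R-matrix, in an arbitrary algebra containing involutions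
`p`, `q`, `r` that satisfy the relations of the three transpositions in the symmetric group on
three letters. -/
lemma yangBaxter_of_transpositions {K A : Type*} [Field K] [Ring A] [Algebra K A] {p q r : A}
    (hp : p * p = 1) (hr : r * r = 1) (hpq : p * q = q * r) (hrp : r * p = q * r)
    (hqp : q * p = p * r) (hrq : r * q = p * r) {x y z : K} (hx : x ≠ 0) (hy : y ≠ 0)
    (hz : z ≠ 0) (h : y = x + z) :
    (1 - x⁻¹ • p) * (1 - y⁻¹ • q) * (1 - z⁻¹ • r) =
      (1 - z⁻¹ • r) * (1 - y⁻¹ • q) * (1 - x⁻¹ • p) := by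
  have key : y⁻¹ * x⁻¹ + y⁻¹ * z⁻¹ = x⁻¹ * z⁻¹ := by
    field_simp
    rw [h]
    ring
  have hpqr : p * (q * r) = q := by rw [← hpq, ← mul_assoc, hp, one_mul]
  simp only [mul_sub, sub_mul, one_mul, mul_one, smul_mul_assoc, mul_smul_comm, mul_assoc,
    hpq, hrp, hqp, hrq, hpqr, hr]
  match_scalars <;> first | ring1 | linear_combination key | linear_combination -key

/-- The Yang–Baxter equation for R-matrices attached to permutations. -/
lemma permR_yangBaxter {ι : Type*} [Fintype ι] [DecidableEq ι] {σ τ ρ : Equiv.Perm ι}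
    (hσ : σ * σ = 1) (hρ : ρ * ρ = 1) (hστ : τ * σ = ρ * τ) (hρσ : σ * ρ = ρ * τ)
    (hτσ : σ * τ = ρ * σ) (hρτ : τ * ρ = ρ * σ) {x y z : ℂ} (hx : x ≠ 0) (hy : y ≠ 0)
    (hz : z ≠ 0) (h : y = x + z) :
    permR σ x * permR τ y * permR ρ z = permR ρ z * permR τ y * permR σ x := by
  apply yangBaxter_of_transpositions _ _ _ _ _ _ hx hy hz h <;>
    simp only [← permMatrix_mul, *, permMatrix_one]

/-- R-matrices attached to commuting permutations commute. -/
lemma permR_commute {ι : Type*} [Fintype ι] [DecidableEq ι] {σ τ : Equiv.Perm ι}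
    (h : Commute σ τ) (x y : ℂ) : Commute (permR σ x) (permR τ y) := by
  have hc : Commute (σ.permMatrix ℂ) (τ.permMatrix ℂ) := by
    rw [Commute, SemiconjBy, ← permMatrix_mul, ← permMatrix_mul, h.eq]
  exact (Commute.one_left _).sub_left
    (((Commute.one_right _).sub_right (hc.smul_right _)).smul_left _)

/-- The permutation of the basis of `(ℂ²)^{⊗4}` exchanging the tensor factors 1 and 2. -/
def swap12 : Equiv.Perm Q4 where
  toFun p := (p.2.1, p.1, p.2.2.1, p.2.2.2)
  invFun p := (p.2.1, p.1, p.2.2.1, p.2.2.2)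
  left_inv _ := rfl
  right_inv _ := rfl

/-- The permutation of the basis of `(ℂ²)^{⊗4}` exchanging the tensor factors 1 and 3. -/
def swap13 : Equiv.Perm Q4 where
  toFun p := (p.2.2.1, p.2.1, p.1, p.2.2.2)
  invFun p := (p.2.2.1, p.2.1, p.1, p.2.2.2)
  left_inv _ := rfl
  right_inv _ := rfl

/-- The permutation of the basis of `(ℂ²)^{⊗4}` exchanging the tensor factors 1 and 4. -/
def swap14 : Equiv.Perm Q4 where
  toFun p := (p.2.2.2, p.2.1, p.2.2.1, p.1)
  invFun p := (p.2.2.2, p.2.1, p.2.2.1, p.1)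
  left_inv _ := rfl
  right_inv _ := rfl

/-- The permutation of the basis of `(ℂ²)^{⊗4}` exchanging the tensor factors 2 and 3. -/
def swap23 : Equiv.Perm Q4 where
  toFun p := (p.1, p.2.2.1, p.2.1, p.2.2.2)
  invFun p := (p.1, p.2.2.1, p.2.1, p.2.2.2)
  left_inv _ := rfl
  right_inv _ := rfl

/-- The permutation of the basis of `(ℂ²)^{⊗4}` exchanging the tensor factors 2 and 4. -/
def swap24 : Equiv.Perm Q4 where
  toFun p := (p.1, p.2.2.2, p.2.2.1, p.2.1)
  invFun p := (p.1, p.2.2.2, p.2.2.1, p.2.1)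
  left_inv _ := rfl
  right_inv _ := rfl

/-- The permutation of the basis of `(ℂ²)^{⊗4}` exchanging the tensor factors 3 and 4. -/
def swap34 : Equiv.Perm Q4 where
  toFun p := (p.1, p.2.1, p.2.2.2, p.2.2.1)
  invFun p := (p.1, p.2.1, p.2.2.2, p.2.2.1)
  left_inv _ := rfl
  right_inv _ := rfl

lemma L12_Ro (u : ℂ) : L12 (Ro u) = permR swap12 u := by
  ext ⟨a, b, c, d⟩ ⟨a', b', c', d'⟩
  simp only [L12, Ro, permR, swap12, Matrix.sub_apply, Matrix.smul_apply, Matrix.one_apply,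
    Pmat_apply_s13, PEquiv.toMatrix_apply, Equiv.toPEquiv_apply, Option.mem_some_iff,
    Equiv.coe_fn_mk, Prod.mk.injEq, smul_eq_mul]
  grind

lemma L13_Ro (u : ℂ) : L13 (Ro u) = permR swap13 u := by
  ext ⟨a, b, c, d⟩ ⟨a', b', c', d'⟩
  simp only [L13, Ro, permR, swap13, Matrix.sub_apply, Matrix.smul_apply, Matrix.one_apply,
    Pmat_apply_s13, PEquiv.toMatrix_apply, Equiv.toPEquiv_apply, Option.mem_some_iff,
    Equiv.coe_fn_mk, Prod.mk.injEq, smul_eq_mul]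
  grind

lemma L14_Ro (u : ℂ) : L14 (Ro u) = permR swap14 u := by
  ext ⟨a, b, c, d⟩ ⟨a', b', c', d'⟩
  simp only [L14, Ro, permR, swap14, Matrix.sub_apply, Matrix.smul_apply, Matrix.one_apply,
    Pmat_apply_s13, PEquiv.toMatrix_apply, Equiv.toPEquiv_apply, Option.mem_some_iff,
    Equiv.coe_fn_mk, Prod.mk.injEq, smul_eq_mul]
  grind

lemma L23_Ro (u : ℂ) : L23 (Ro u) = permR swap23 u := by
  ext ⟨a, b, c, d⟩ ⟨a', b', c', d'⟩
  simp only [L23, Ro, permR, swap23, Matrix.sub_apply, Matrix.smul_apply, Matrix.one_apply,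
    Pmat_apply_s13, PEquiv.toMatrix_apply, Equiv.toPEquiv_apply, Option.mem_some_iff,
    Equiv.coe_fn_mk, Prod.mk.injEq, smul_eq_mul]
  grind

lemma L24_Ro (u : ℂ) : L24 (Ro u) = permR swap24 u := by
  ext ⟨a, b, c, d⟩ ⟨a', b', c', d'⟩
  simp only [L24, Ro, permR, swap24, Matrix.sub_apply, Matrix.smul_apply, Matrix.one_apply,
    Pmat_apply_s13, PEquiv.toMatrix_apply, Equiv.toPEquiv_apply, Option.mem_some_iff,
    Equiv.coe_fn_mk, Prod.mk.injEq, smul_eq_mul]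
  grind

lemma L34_Ro (u : ℂ) : L34 (Ro u) = permR swap34 u := by
  ext ⟨a, b, c, d⟩ ⟨a', b', c', d'⟩
  simp only [L34, Ro, permR, swap34, Matrix.sub_apply, Matrix.smul_apply, Matrix.one_apply,
    Pmat_apply_s13, PEquiv.toMatrix_apply, Equiv.toPEquiv_apply, Option.mem_some_iff,
    Equiv.coe_fn_mk, Prod.mk.injEq, smul_eq_mul]
  grind

/-- the two fused expressions (RV:0) and (RV:1) for the `so₃` R-matrix agree:
`R°₁₂(-1) R°₃₄(-1) R°₁₄(2u-1) R°₁₃(2u) R°₂₄(2u) R°₂₃(2u+1)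
  = R°₂₃(2u+1) R°₂₄(2u) R°₁₃(2u) R°₁₄(2u-1) R°₁₂(-1) R°₃₄(-1)`. -/
theorem fused_R_equality (u : ℂ) (h1 : 2 * u - 1 ≠ 0) (h0 : 2 * u ≠ 0) (h2 : 2 * u + 1 ≠ 0) :
    L12 (Ro (-1)) * L34 (Ro (-1)) * L14 (Ro (2 * u - 1)) * L13 (Ro (2 * u)) *
        L24 (Ro (2 * u)) * L23 (Ro (2 * u + 1)) =
      L23 (Ro (2 * u + 1)) * L24 (Ro (2 * u)) * L13 (Ro (2 * u)) * L14 (Ro (2 * u - 1)) *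
        L12 (Ro (-1)) * L34 (Ro (-1)) := by
  simp only [L12_Ro, L13_Ro, L14_Ro, L23_Ro, L24_Ro, L34_Ro]
  have hm : (-1 : ℂ) ≠ 0 := by norm_num
  have y123 := permR_yangBaxter (σ := swap12) (τ := swap13) (ρ := swap23)
    rfl rfl rfl rfl rfl rfl hm h0 h2 (by ring)
  have y124 := permR_yangBaxter (σ := swap12) (τ := swap14) (ρ := swap24)
    rfl rfl rfl rfl rfl rfl hm h1 h0 (by ring)
  have y134 := permR_yangBaxter (σ := swap13) (τ := swap14) (ρ := swap34)
    rfl rfl rfl rfl rfl rfl h0 h1 hm (by ring)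
  have y234 := permR_yangBaxter (σ := swap23) (τ := swap24) (ρ := swap34)
    rfl rfl rfl rfl rfl rfl h2 h0 hm (by ring)
  have c1423 := permR_commute (σ := swap14) (τ := swap23) rfl (2 * u - 1) (2 * u + 1)
  have c1324 := permR_commute (σ := swap13) (τ := swap24) rfl (2 * u) (2 * u)
  generalize permR swap12 (-1) = A at *
  generalize permR swap34 (-1) = B at *
  generalize permR swap14 (2 * u - 1) = C at *
  generalize permR swap13 (2 * u) = D at *
  generalize permR swap24 (2 * u) = E at *
  generalize permR swap23 (2 * u + 1) = F at *
  calc A * B * C * D * E * F = A * (B * C * D) * E * F := by noncomm_ring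
    _ = A * D * C * (B * E * F) := by rw [← y134]; noncomm_ring
    _ = A * D * (C * F) * E * B := by rw [← y234]; noncomm_ring
    _ = (A * D * F) * C * E * B := by rw [c1423.eq]; noncomm_ring
    _ = F * D * (A * C * E) * B := by rw [y123]; noncomm_ring
    _ = F * (D * E) * C * A * B := by rw [y124]; noncomm_ring
    _ = F * E * D * C * A * B := by rw [c1324.eq]; noncomm_ring
end
end
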